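/- Let M and N be normal subgroups of a finite group G with an isomorphism f : G/N → G/M, and let Φ ∈ Hom(G*, 𝕂ˣ) satisfy Φ_N ∘ f* = Φ_M. Then m^M_{(G,Φ)} = m^N_{(G,Φ)}. -/

import Mathlib

open scoped Classical

section FiberedBurnside

variable {A : Type*} [CommGroup A]

/-- Conjugation action on pairs `(U, φ)` with `U ≤ G` and `φ : U →* A`:
`ᵍ(U,φ) = (ᵍU, ᵍφ)`. -/
def pairConj {G : Type*} [Group G] (g : G) (p : Σ U : Subgroup G, (↥U →* A)) :
    Σ U : Subgroup G, (↥U →* A) :=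
  ⟨p.1.map ((MulAut.conj g : G ≃* G) : G →* G),
    p.2.comp ((MulEquiv.subgroupMap (MulAut.conj g : G ≃* G) p.1).symm.toMonoidHom)⟩

/-- `R` is a set of representatives for the `(H,K)`-double cosets in `G`. -/
def IsDCR {G : Type*} [Group G] (H K : Subgroup G) (R : Finset G) : Prop :=
  (∀ x : G, ∃ r ∈ R, ∃ h ∈ H, ∃ k ∈ K, x = h * r * k) ∧
    ∀ r ∈ R, ∀ r' ∈ R, (∃ h ∈ H, ∃ k ∈ K, r' = h * r * k) → r = r'

/-- The pair `(U ∩ ᵍV, φ|·(ᵍψ)|)` occurring in the product formula. -/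
def mulPair {G : Type*} [Group G] (p q : Σ U : Subgroup G, (↥U →* A)) (g : G) :
    Σ U : Subgroup G, (↥U →* A) :=
  ⟨p.1 ⊓ (pairConj g q).1,
    (p.2.comp (Subgroup.inclusion inf_le_left)) *
      ((pairConj g q).2.comp (Subgroup.inclusion inf_le_right))⟩

/-- Data exhibiting a `𝕂`-algebra `B` as the `A`-fibered Burnside algebra `B^A_𝕂(G)`:
the standard basis elements `b (U,φ) = [U,φ]_G` are conjugation invariant, span, are
linearly independent over pairwise non-conjugate pairs, `[G,1]_G = 1`, and multiply by the
double coset formula. -/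
structure FiberedBurnsideData (A : Type*) [CommGroup A] (G : Type*) [Group G]
    (𝕂 : Type*) [Field 𝕂] (B : Type*) [Ring B] [Algebra 𝕂 B] where
  b : (Σ U : Subgroup G, (↥U →* A)) → B
  b_conj : ∀ (g : G) (p), b (pairConj g p) = b p
  b_one : b ⟨⊤, 1⟩ = 1
  b_span : Submodule.span 𝕂 (Set.range b) = ⊤
  b_indep : ∀ s : Finset (Σ U : Subgroup G, (↥U →* A)),
      (∀ p ∈ s, ∀ q ∈ s, (∃ g : G, pairConj g p = q) → p = q) →
      LinearIndependent 𝕂 (fun p : {x // x ∈ s} => b p.1)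
  b_mul : ∀ (p q) (R : Finset G), IsDCR p.1 q.1 R →
      b p * b q = ∑ r ∈ R, b (mulPair p q r)

end FiberedBurnside

/-- Conjugation action on pairs `(H, Φ)` with `H ≤ G` and `Φ` a `C`-valued character of the
character group `Hom(H,A)`:  `ᵍ(H,Φ) = (ᵍH, ᵍΦ)` where `ᵍΦ(φ') = Φ(ᵍ⁻¹φ')`. -/
def charPairConj {G : Type*} [Group G] {A : Type*} [CommGroup A] {C : Type*} [CommGroup C]
    (g : G) (x : Σ H : Subgroup G, ((↥H →* A) →* C)) :
    Σ H : Subgroup G, ((↥H →* A) →* C) :=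
  ⟨x.1.map ((MulAut.conj g : G ≃* G) : G →* G),
    x.2.comp
      { toFun := fun φ' =>
          φ'.comp ((MulEquiv.subgroupMap (MulAut.conj g : G ≃* G) x.1).toMonoidHom)
        map_one' := MonoidHom.one_comp _
        map_mul' := fun _ _ => MonoidHom.mul_comp _ _ _ }⟩

/-- Pullback (e.g. inflation) of `A`-valued characters of the full group along a
homomorphism `f : G → G'`, written for the full subgroups `⊤`. -/
def charPull {G G' : Type*} [Group G] [Group G'] (A : Type*) [CommGroup A] (f : G →* G') :
    (↥(⊤ : Subgroup G') →* A) →* (↥(⊤ : Subgroup G) →* A) where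
  toFun χ := χ.comp ((f.comp (Subgroup.subtype ⊤)).codRestrict ⊤ fun _ => Subgroup.mem_top _)
  map_one' := MonoidHom.one_comp _
  map_mul' _ _ := MonoidHom.mul_comp _ _ _

section Comb

theorem exists_mu (α : Type*) [Fintype α] [PartialOrder α] :
    ∃ μ : α → α → ℤ,
      (∀ a b, ∑ x, (if a ≤ x ∧ x ≤ b then μ a x else 0) = if a = b then 1 else 0) ∧
      (∀ a b, ∑ x, (if a ≤ x ∧ x ≤ b then μ x b else 0) = if a = b then 1 else 0) := by
  let _ : LocallyFiniteOrder α := Fintype.toLocallyFiniteOrder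
  refine ⟨fun a b => IncidenceAlgebra.mu ℤ a b, fun a b => ?_, fun a b => ?_⟩
  · rw [← IncidenceAlgebra.sum_Icc_mu_right, ← Finset.sum_filter]
    congr 1
    ext x; simp
  · rw [← IncidenceAlgebra.sum_Icc_mu_left, ← Finset.sum_filter]
    congr 1
    ext x; simp

/-- uniqueness of the Moebius function towards the top -/
theorem mu_unique {α : Type*} [Fintype α] [PartialOrder α] (c d : α → ℤ)
    (h : ∀ a, ∑ x, (if a ≤ x then c x else 0) = ∑ x, (if a ≤ x then d x else 0)) : c = d := by
  funext a
  induction a using (wellFounded_gt (α := α)).induction with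
  | _ a ih =>
    have key : ∀ e : α → ℤ, ∑ x, (if a ≤ x then e x else 0)
        = e a + ∑ x, (if a < x then e x else 0) := by
      intro e
      rw [← Fintype.sum_ite_eq a e, ← Finset.sum_add_distrib]
      refine Finset.sum_congr rfl fun x _ => ?_
      by_cases hx : a = x
      · subst hx; simp
      · simp [hx, lt_iff_le_and_ne]
    have h1 := h a
    rw [key, key] at h1
    have h2 : ∑ x, (if a < x then c x else 0) = ∑ x, (if a < x then d x else 0) := by
      refine Finset.sum_congr rfl fun x _ => ?_
      split_ifs with hx
      · exact ih x hx
      · rfl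
    linarith

theorem exists_desc {A G Q : Type*} [CommGroup A] [Group G] [Group Q] (π : G →* Q)
    (K : Subgroup G) (hK : K.map π = ⊤) (φ : K →* A) (hφ : ∀ k : K, π k = 1 → φ k = 1) :
    ∃ η : Q →* A, ∀ k : K, η (π k) = φ k := by
  have hs : Function.Surjective (π.comp K.subtype) := by
    intro q
    have : q ∈ K.map π := by rw [hK]; trivial
    obtain ⟨k, hk, rfl⟩ := this
    exact ⟨⟨k, hk⟩, rfl⟩
  refine ⟨MonoidHom.liftOfSurjective _ hs ⟨φ, fun k hk => hφ k hk⟩, fun k => ?_⟩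
  exact MonoidHom.liftOfRightInverse_comp_apply _ _ _ _ k

/-- Pullback of characters. -/
def pullHom {G Q : Type*} [Group G] [Group Q] (A : Type*) [CommGroup A] (π : G →* Q) :
    (Q →* A) →* (G →* A) where
  toFun χ := χ.comp π
  map_one' := MonoidHom.one_comp _
  map_mul' _ _ := MonoidHom.mul_comp _ _ _

@[simp] theorem pullHom_apply {G Q A : Type*} [Group G] [Group Q] [CommGroup A] (π : G →* Q)
    (χ : Q →* A) : pullHom A π χ = χ.comp π := rfl

variable {A 𝕂 : Type*} [CommGroup A] [Field 𝕂]

/-- The sum of `Φ` over the annihilator of `K`. -/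
noncomputable def annSum {G : Type*} [Group G] [Fintype (G →* A)] (Φ : (G →* A) →* 𝕂ˣ)
    (K : Subgroup G) : 𝕂 :=
  ∑ κ : G →* A, if ∀ k ∈ K, κ k = 1 then (Φ κ : 𝕂) else 0

theorem annSum_mul {G Q : Type*} [Group G] [Group Q] [Fintype (G →* A)] [Fintype (Q →* A)]
    (π : G →* Q) (Φ : (G →* A) →* 𝕂ˣ) (K : Subgroup G) (hK : K.map π = ⊤) (H : Subgroup Q) :
    annSum Φ K * annSum (Φ.comp (pullHom A π)) H = annSum Φ (K ⊓ H.comap π) := by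
  unfold annSum
  simp_rw [← Finset.sum_filter]
  rw [Finset.sum_mul_sum, ← Finset.sum_product']
  have hlift : ∀ q : Q, ∃ k ∈ K, π k = q := by
    intro q
    have : q ∈ K.map π := by rw [hK]; trivial
    exact this
  refine Finset.sum_bij (fun x _ => x.1 * x.2.comp π) ?_ ?_ ?_ ?_
  · rintro ⟨κ, η⟩ h
    simp only [Finset.mem_product, Finset.mem_filter, Finset.mem_univ, true_and] at h ⊢
    intro k hk
    have := h.1 k hk.1
    have h2 := h.2 (π k) hk.2
    simp [this, h2]
  · rintro ⟨κ, η⟩ h ⟨κ', η'⟩ h' e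
    simp only [Finset.mem_product, Finset.mem_filter, Finset.mem_univ, true_and] at h h' e
    have hη : η = η' := by
      ext q
      obtain ⟨k, hk, rfl⟩ := hlift q
      have := DFunLike.congr_fun e k
      simpa [h.1 k hk, h'.1 k hk] using this
    subst hη
    simpa using e
  · intro χ hχ
    simp only [Finset.mem_filter, Finset.mem_univ, true_and] at hχ
    obtain ⟨η, hη⟩ := exists_desc π K hK (χ.comp K.subtype) (by
      intro k hk
      exact hχ k ⟨k.2, by simp [hk]⟩)
    refine ⟨⟨χ * (η.comp π)⁻¹, η⟩, ?_, ?_⟩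
    · simp only [Finset.mem_product, Finset.mem_filter, Finset.mem_univ, true_and]
      refine ⟨fun k hk => ?_, fun q hq => ?_⟩
      · have := hη ⟨k, hk⟩
        simp at this
        simp [this]
      · obtain ⟨k, hk, rfl⟩ := hlift q
        have := hη ⟨k, hk⟩
        simp at this
        rw [this]
        exact hχ k ⟨hk, hq⟩
    · simp
  · rintro ⟨κ, η⟩ h
    simp

theorem mu_factor {G Q : Type*} [Group G] [Group Q] [Fintype (Subgroup G)]
    [Fintype (Subgroup Q)] (π : G →* Q)
    (μ : Subgroup G → ℤ) (hμ : ∀ a, ∑ x, (if a ≤ x then μ x else 0) = if a = ⊤ then 1 else 0)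
    (ν : Subgroup Q → ℤ) (hν : ∀ a, ∑ x, (if a ≤ x then ν x else 0) = if a = ⊤ then 1 else 0)
    (hπ : Function.Surjective π)
    (L : Subgroup G) :
    ∑ K : Subgroup G, ∑ H : Subgroup Q,
      (if K.map π = ⊤ ∧ K ⊓ H.comap π = L then μ K * ν H else 0) = μ L := by
  suffices h : (fun L => ∑ K : Subgroup G, ∑ H : Subgroup Q,
      (if K.map π = ⊤ ∧ K ⊓ H.comap π = L then μ K * ν H else 0)) = μ from congr_fun h L
  apply mu_unique
  intro J
  rw [hμ]
  have h1 : ∑ L : Subgroup G, (if J ≤ L then ∑ K : Subgroup G, ∑ H : Subgroup Q,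
      (if K.map π = ⊤ ∧ K ⊓ H.comap π = L then μ K * ν H else 0) else 0)
      = ∑ K : Subgroup G, ∑ H : Subgroup Q,
        (if K.map π = ⊤ ∧ J ≤ K then μ K else 0) * (if J.map π ≤ H then ν H else 0) := by
    rw [← Finset.sum_filter, Finset.sum_comm]
    refine Finset.sum_congr rfl fun K _ => ?_
    rw [Finset.sum_comm]
    refine Finset.sum_congr rfl fun H _ => ?_
    rw [Finset.sum_filter]
    rw [Finset.sum_eq_single (K ⊓ H.comap π)]
    · by_cases a : J ≤ K <;> by_cases b : J ≤ H.comap π <;> by_cases c : K.map π = ⊤ <;>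
        simp [a, b, c, Subgroup.map_le_iff_le_comap]
    · intro L _ hL
      simp [Ne.symm hL]
    · simp
  rw [h1]
  simp_rw [← Finset.mul_sum]
  rw [← Finset.sum_mul, hν]
  by_cases hJ : J.map π = ⊤
  · rw [if_pos hJ, mul_one, ← hμ]
    refine Finset.sum_congr rfl fun K _ => ?_
    by_cases hK : J ≤ K
    · have : K.map π = ⊤ := by
        rw [eq_top_iff, ← hJ]; exact Subgroup.map_mono hK
      simp [hK, this]
    · simp [hK]
  · have : J ≠ ⊤ := by
      rintro rfl
      exact hJ (by rw [← MonoidHom.range_eq_map, MonoidHom.range_eq_top]; exact hπ)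
    simp [hJ, this]

theorem card_factor {G Q : Type*} [Group G] [Group Q] [Finite G] [Finite Q]
    (π : G →* Q) (K : Subgroup G) (hK : K.map π = ⊤) (H : Subgroup Q) :
    Nat.card K * Nat.card H = Nat.card Q * Nat.card (K ⊓ H.comap π : Subgroup G) := by
  have hs : Function.Surjective (π.comp K.subtype) := by
    intro q
    have : q ∈ K.map π := by rw [hK]; trivial
    obtain ⟨k, hk, rfl⟩ := this
    exact ⟨⟨k, hk⟩, rfl⟩
  have h1 := H.index_comap_of_surjective hs
  have h2 := (H.comap (π.comp K.subtype)).card_mul_index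
  have h3 := H.card_mul_index
  have h4 : Nat.card (H.comap (π.comp K.subtype)) = Nat.card (K ⊓ H.comap π : Subgroup G) := by
    rw [← Subgroup.comap_comap, inf_comm]
    exact Nat.card_congr
      { toFun := fun x => ⟨x.1.1, x.2, x.1.2⟩
        invFun := fun x => ⟨⟨x.1, x.2.2⟩, x.2.1⟩
        left_inv := fun _ => rfl
        right_inv := fun _ => rfl }
  rw [h4, h1] at h2
  rw [← h2, ← h3]
  ring

theorem dirichlet_factor {G Q : Type*} [Group G] [Group Q] [Finite G] [Finite Q]
    [Fintype (Subgroup G)] [Fintype (Subgroup Q)]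
    [Fintype (G →* A)] [Fintype (Q →* A)]
    (π : G →* Q) (hπ : Function.Surjective π) (Φ : (G →* A) →* 𝕂ˣ)
    (μ : Subgroup G → ℤ) (hμ : ∀ a, ∑ x, (if a ≤ x then μ x else 0) = if a = ⊤ then 1 else 0)
    (ν : Subgroup Q → ℤ) (hν : ∀ a, ∑ x, (if a ≤ x then ν x else 0) = if a = ⊤ then 1 else 0)
    (s : ℕ) :
    (∑ K : Subgroup G, (if K.map π = ⊤ then (μ K : 𝕂) * annSum Φ K else 0)
        * (Nat.card K : 𝕂) ^ s) *
      (∑ H : Subgroup Q, (ν H : 𝕂) * annSum (Φ.comp (pullHom A π)) H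
        * (Nat.card H : 𝕂) ^ s)
    = (Nat.card Q : 𝕂) ^ s * ∑ L : Subgroup G, (μ L : 𝕂) * annSum Φ L * (Nat.card L : 𝕂) ^ s := by
  rw [Finset.sum_mul_sum]
  have h1 : ∀ (K : Subgroup G) (H : Subgroup Q),
      ((if K.map π = ⊤ then (μ K : 𝕂) * annSum Φ K else 0) * (Nat.card K : 𝕂) ^ s) *
      ((ν H : 𝕂) * annSum (Φ.comp (pullHom A π)) H * (Nat.card H : 𝕂) ^ s)
      = ∑ L : Subgroup G,
        ((if K.map π = ⊤ ∧ K ⊓ H.comap π = L then μ K * ν H else 0 : ℤ) : 𝕂) *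
        ((Nat.card Q : 𝕂) ^ s * (annSum Φ L * (Nat.card L : 𝕂) ^ s)) := by
    intro K H
    rw [Finset.sum_eq_single (K ⊓ H.comap π)]
    · by_cases hK : K.map π = ⊤
      · have e1 := annSum_mul π Φ K hK H
        have e2 : (Nat.card K : 𝕂) * Nat.card H
          = Nat.card Q * Nat.card (K ⊓ H.comap π : Subgroup G) := by
          rw [← Nat.cast_mul, ← Nat.cast_mul, card_factor π K hK H]
        rw [if_pos hK, if_pos ⟨hK, rfl⟩, ← e1]
        push_cast
        have e3 : (Nat.card K : 𝕂) ^ s * (Nat.card H : 𝕂) ^ s = (Nat.card Q : 𝕂) ^ s *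
            (Nat.card (K ⊓ H.comap π : Subgroup G) : 𝕂) ^ s := by
          rw [← mul_pow, e2, mul_pow]
        linear_combination (μ K : 𝕂) * annSum Φ K * ν H *
          annSum (Φ.comp (pullHom A π)) H * e3
      · simp [hK]
    · intro L _ hL
      simp [Ne.symm hL]
    · simp
  simp_rw [h1]
  have h2 : ∀ L : Subgroup G, (μ L : 𝕂) * annSum Φ L * (Nat.card L : 𝕂) ^ s =
      ∑ K : Subgroup G, ∑ H : Subgroup Q,
      ((if K.map π = ⊤ ∧ K ⊓ H.comap π = L then μ K * ν H else 0 : ℤ) : 𝕂) *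
        (annSum Φ L * (Nat.card L : 𝕂) ^ s) := by
    intro L
    simp_rw [← Finset.sum_mul]
    rw [← mu_factor π μ hμ ν hν hπ L]
    push_cast
    ring
  simp_rw [h2, Finset.mul_sum]
  rw [Finset.sum_comm (s := (Finset.univ : Finset (Subgroup G)))
    (t := (Finset.univ : Finset (Subgroup G)))]
  conv_lhs =>
    enter [2, K]
    rw [Finset.sum_comm]
  rw [Finset.sum_comm]
  rw [Finset.sum_comm]
  refine Finset.sum_congr rfl fun _ _ => Finset.sum_congr rfl fun _ _ =>
    Finset.sum_congr rfl fun _ _ => by ring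

theorem annSum_nat {G : Type*} [Group G] [Fintype (G →* A)] (Φ : (G →* A) →* 𝕂ˣ)
    (K : Subgroup G) : ∃ n : ℕ, annSum Φ K = n := by
  let P : Subgroup (G →* A) :=
    { carrier := {κ | ∀ k ∈ K, κ k = 1}
      mul_mem' := fun {a b} ha hb k hk => by simp [ha k hk, hb k hk]
      one_mem' := fun k hk => rfl
      inv_mem' := fun {a} ha k hk => by simp [ha k hk] }
  let F : P →* 𝕂 := (Units.coeHom 𝕂).comp (Φ.comp P.subtype)
  have h : annSum Φ K = ∑ x : P, F x := by
    unfold annSum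
    rw [← Finset.sum_filter]
    exact Finset.sum_subtype _ (fun x => by simp [P, ← SetLike.mem_coe]) (fun κ => (Φ κ : 𝕂))
  by_cases hF : F = 1
  · exact ⟨Fintype.card P, by rw [h, hF]; simp⟩
  · exact ⟨0, by rw [h, sum_hom_units_eq_zero F hF]; simp⟩

theorem annSum_top {G : Type*} [Group G] [Fintype (G →* A)] (Φ : (G →* A) →* 𝕂ˣ) :
    annSum Φ (⊤ : Subgroup G) = 1 := by
  unfold annSum
  rw [Finset.sum_eq_single 1]
  · simp
  · intro κ _ h
    rw [if_neg]
    intro h'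
    exact h (by ext x; exact h' x trivial)
  · simp

theorem eventually_ne [CharZero 𝕂] {Q : Type*} [Group Q] [Finite Q]
    [Fintype (Subgroup Q)] [Fintype (Q →* A)] (Ψ : (Q →* A) →* 𝕂ˣ)
    (ν : Subgroup Q → ℤ) (hν : ∀ a, ∑ x, (if a ≤ x then ν x else 0) = if a = ⊤ then 1 else 0) :
    ∃ s0 : ℕ, ∀ s ≥ s0, ∑ H : Subgroup Q, (ν H : 𝕂) * annSum Ψ H * (Nat.card H : 𝕂) ^ s ≠ 0 := by
  choose w hw using annSum_nat Ψ
  have hw1 : w ⊤ = 1 := by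
    have := hw ⊤
    rw [annSum_top] at this
    exact_mod_cast this.symm
  have hν1 : ν ⊤ = 1 := by
    have := hν ⊤
    simpa using this
  have hq : 0 < (Nat.card Q : ℝ) := by exact_mod_cast Nat.card_pos
  have ht : Filter.Tendsto (fun s : ℕ => ∑ H : Subgroup Q,
      (ν H : ℝ) * (w H : ℝ) * ((Nat.card H : ℝ) / Nat.card Q) ^ s) Filter.atTop
      (nhds (∑ H : Subgroup Q, if H = ⊤ then 1 else 0)) := by
    refine tendsto_finsetSum _ fun H _ => ?_
    split_ifs with hH
    · subst hH
      simp [hw1, hν1, hq.ne']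
    · have : (Nat.card H : ℝ) / Nat.card Q < 1 := by
        rw [div_lt_one hq]
        have h1 : Nat.card H ≤ Nat.card Q := Subgroup.card_le_card_group H
        have h2 : Nat.card H ≠ Nat.card Q := fun h => hH (Subgroup.eq_top_of_card_eq H h)
        exact_mod_cast lt_of_le_of_ne h1 h2
      have := (tendsto_pow_atTop_nhds_zero_of_lt_one (by positivity) this).const_mul
        ((ν H : ℝ) * (w H : ℝ))
      simpa using this
  have h1 : (∑ H : Subgroup Q, if H = ⊤ then (1 : ℝ) else 0) = 1 := by simp
  rw [h1] at ht
  have := ht.eventually_ne one_ne_zero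
  obtain ⟨s0, hs0⟩ := Filter.eventually_atTop.1 this
  refine ⟨s0, fun s hs h => hs0 s hs ?_⟩
  have h2 : (∑ H : Subgroup Q, ν H * (w H : ℤ) * (Nat.card H : ℤ) ^ s) = 0 := by
    have : ((∑ H : Subgroup Q, ν H * (w H : ℤ) * (Nat.card H : ℤ) ^ s : ℤ) : 𝕂) = 0 := by
      push_cast
      rw [← h]
      exact Finset.sum_congr rfl fun H _ => by rw [hw]
    exact_mod_cast this
  have h3 : (∑ H : Subgroup Q, (ν H : ℝ) * (w H : ℝ) * (Nat.card H : ℝ) ^ s) = 0 := by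
    exact_mod_cast congrArg (fun z : ℤ => (z : ℝ)) h2
  simp_rw [div_pow, ← mul_div_assoc]
  rw [← Finset.sum_div, h3, zero_div]

theorem dirichlet_zero {ι : Type*} [Fintype ι] (a d : ι → 𝕂) (hd : ∀ i, d i ≠ 0) (s0 : ℕ)
    (h : ∀ s ≥ s0, ∑ i, a i * d i ^ s = 0) : ∑ i, a i * d i = 0 := by
  let p : Polynomial 𝕂 := Lagrange.interpolate (Finset.univ.image d) id
    (fun x => x * (x ^ s0)⁻¹)
  have hp : ∀ i, p.eval (d i) = d i * (d i ^ s0)⁻¹ := by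
    intro i
    exact Lagrange.eval_interpolate_at_node (s := Finset.univ.image d) (v := id)
      (fun x => x * (x ^ s0)⁻¹) (Set.injOn_id _) (by simp)
  have h1 : ∀ i, a i * d i = ∑ n ∈ Finset.range (p.natDegree + 1),
      p.coeff n * (a i * d i ^ (s0 + n)) := by
    intro i
    have h2 := hp i
    rw [Polynomial.eval_eq_sum_range] at h2
    calc a i * d i = a i * d i ^ s0 * (d i * (d i ^ s0)⁻¹) := by
          have := pow_ne_zero s0 (hd i)
          field_simp
      _ = _ := by
          rw [← h2, Finset.mul_sum]
          exact Finset.sum_congr rfl fun n _ => by ring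
  simp_rw [h1]
  rw [Finset.sum_comm]
  refine Finset.sum_eq_zero fun n _ => ?_
  rw [← Finset.mul_sum, h _ (by omega), mul_zero]

theorem comb_main [CharZero 𝕂] {G Q : Type*} [Group G] [Group Q] [Finite G] [Finite Q]
    [Fintype (Subgroup G)] [Fintype (G →* A)] [Fintype (Q →* A)]
    (π ρ : G →* Q) (hπ : Function.Surjective π) (hρ : Function.Surjective ρ)
    (Φ : (G →* A) →* 𝕂ˣ)
    (hΦ : Φ.comp (pullHom A π) = Φ.comp (pullHom A ρ))
    (μ : Subgroup G → ℤ) (hμ : ∀ a, ∑ x, (if a ≤ x then μ x else 0) = if a = ⊤ then 1 else 0) :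
    ∑ K : Subgroup G, (if K.map π = ⊤ then (μ K : 𝕂) * annSum Φ K else 0) * (Nat.card K : 𝕂) =
    ∑ K : Subgroup G, (if K.map ρ = ⊤ then (μ K : 𝕂) * annSum Φ K else 0) * (Nat.card K : 𝕂) := by
  have : Fintype (Subgroup Q) := Fintype.ofFinite _
  obtain ⟨m, -, hm⟩ := exists_mu (Subgroup Q)
  have hν : ∀ a, ∑ x, (if a ≤ x then m x ⊤ else 0) = if a = ⊤ then 1 else 0 := by
    intro a
    simpa using hm a ⊤
  obtain ⟨s0, hs0⟩ := eventually_ne (Φ.comp (pullHom A π)) (fun x => m x ⊤) hν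
  rw [← sub_eq_zero, ← Finset.sum_sub_distrib]
  simp_rw [← sub_mul]
  refine dirichlet_zero _ _ (fun K => by exact_mod_cast Nat.card_pos.ne') s0 fun s hs => ?_
  have e1 := dirichlet_factor π hπ Φ μ hμ _ hν s
  have e2 := dirichlet_factor ρ hρ Φ μ hμ _ hν s
  rw [← hΦ, ← e1] at e2
  have e3 := mul_right_cancel₀ (hs0 s hs) e2
  simp_rw [sub_mul]
  rw [Finset.sum_sub_distrib, e3, sub_self]

end Comb

section Idem

variable {A 𝕂 : Type*} [CommGroup A] [Field 𝕂]

theorem mem_pairConj {G : Type*} [Group G] (g : G) (p : Σ U : Subgroup G, (↥U →* A)) (x : G) :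
    x ∈ (pairConj g p).1 ↔ g⁻¹ * x * g ∈ p.1 := by
  change x ∈ p.1.map _ ↔ _
  rw [Subgroup.mem_map]
  constructor
  · rintro ⟨y, hy, rfl⟩
    simpa [mul_assoc] using hy
  · intro h
    exact ⟨_, h, by simp [mul_assoc]⟩

theorem pairConj_apply {G : Type*} [Group G] (g : G) (p : Σ U : Subgroup G, (↥U →* A)) (x : G)
    (hx : x ∈ (pairConj g p).1) :
    (pairConj g p).2 ⟨x, hx⟩ = p.2 ⟨g⁻¹ * x * g, (mem_pairConj g p x).1 hx⟩ := by
  change p.2 _ = _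
  congr 1

/-- A summand of the species. -/
noncomputable def spTerm {G : Type*} [Group G] (p : Σ U : Subgroup G, (↥U →* A))
    (K : Subgroup G) (Ψ : (↥K →* A) →* 𝕂ˣ) (r : G) : 𝕂 :=
  if h : K ≤ (pairConj r p).1 then
    ((Ψ ((pairConj r p).2.comp (Subgroup.inclusion h)) : 𝕂ˣ) : 𝕂) else 0

theorem spTerm_congr {G : Type*} [Group G] (p : Σ U : Subgroup G, (↥U →* A))
    (K : Subgroup G) (Ψ : (↥K →* A) →* 𝕂ˣ) (r k u : G) (hk : k ∈ K) (hu : u ∈ p.1) :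
    spTerm p K Ψ (k * r * u) = spTerm p K Ψ r := by
  have hu' : u⁻¹ ∈ p.1 := p.1.inv_mem hu
  have key : ∀ x, x ∈ (pairConj (k * r * u) p).1 ↔ k⁻¹ * x * k ∈ (pairConj r p).1 := by
    intro x
    rw [mem_pairConj, mem_pairConj]
    have : (k * r * u)⁻¹ * x * (k * r * u) = u⁻¹ * (r⁻¹ * (k⁻¹ * x * k) * r) * u := by group
    rw [this, p.1.mul_mem_cancel_right hu, p.1.mul_mem_cancel_left hu']
  have hiff : K ≤ (pairConj (k * r * u) p).1 ↔ K ≤ (pairConj r p).1 := by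
    constructor
    · intro h x hx
      have := (key (k * x * k⁻¹)).1 (h (K.mul_mem (K.mul_mem hk hx) (K.inv_mem hk)))
      simpa [mul_assoc] using this
    · intro h x hx
      exact (key x).2 (h (K.mul_mem (K.mul_mem (K.inv_mem hk) hx) hk))
  unfold spTerm
  by_cases h : K ≤ (pairConj r p).1
  · have h' := hiff.2 h
    rw [dif_pos h, dif_pos h']
    congr 2
    ext ⟨x, hx⟩
    change (pairConj (k * r * u) p).2 ⟨x, h' hx⟩ = (pairConj r p).2 ⟨x, h hx⟩
    have e1 : (pairConj r p).2 ⟨x, h hx⟩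
        = (pairConj r p).2 (⟨k, h hk⟩⁻¹ * ⟨x, h hx⟩ * ⟨k, h hk⟩) := by
      rw [map_mul, map_mul, map_inv, mul_comm, mul_inv_cancel_left]
    rw [e1]
    have e2 : (⟨k, h hk⟩⁻¹ * ⟨x, h hx⟩ * ⟨k, h hk⟩ : (pairConj r p).1)
      = ⟨k⁻¹ * x * k, (key x).1 (h' hx)⟩ := rfl
    rw [e2, pairConj_apply, pairConj_apply]
    have e3 : (⟨(k * r * u)⁻¹ * x * (k * r * u), (mem_pairConj _ p x).1 (h' hx)⟩ : p.1)
      = ⟨u, hu⟩⁻¹ * ⟨r⁻¹ * (k⁻¹ * x * k) * r,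
          (mem_pairConj _ p _).1 ((key x).1 (h' hx))⟩ * ⟨u, hu⟩ := by
      ext
      simp [mul_assoc]
    rw [e3, map_mul, map_mul, map_inv, mul_comm, mul_inv_cancel_left]
  · rw [dif_neg h, dif_neg (fun h' => h (hiff.1 h'))]

theorem exists_DCR {G : Type*} [Group G] [Fintype G] (H K : Subgroup G) :
    ∃ R : Finset G, IsDCR H K R := by
  let S := DoubleCoset.setoid (H : Set G) (K : Set G)
  refine ⟨Finset.univ.image (fun g : G => (Quotient.mk S g).out), ?_, ?_⟩
  · intro x
    refine ⟨(Quotient.mk S x).out, by simp, ?_⟩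
    have : S (Quotient.mk S x).out x := Quotient.mk_out x
    exact DoubleCoset.rel_iff.1 this
  · intro r hr r' hr' h
    simp only [Finset.mem_image, Finset.mem_univ, true_and] at hr hr'
    obtain ⟨g, rfl⟩ := hr
    obtain ⟨g', rfl⟩ := hr'
    have h1 : S (Quotient.mk S g).out (Quotient.mk S g').out := DoubleCoset.rel_iff.2 h
    have h2 := Quotient.sound (s := S) h1
    rw [Quotient.out_eq, Quotient.out_eq] at h2
    rw [h2]

theorem sum_spTerm {G : Type*} [Group G] [Fintype G] (p : Σ U : Subgroup G, (↥U →* A))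
    (K : Subgroup G) (Ψ : (↥K →* A) →* 𝕂ˣ) (R : Finset G) (hR : IsDCR K p.1 R) :
    ∑ g : G, spTerm p K Ψ g = (Nat.card p.1 : 𝕂) * ∑ r ∈ R, spTerm p K Ψ r := by
  choose ρ hρR hρ using hR.1
  rw [← Finset.sum_fiberwise_of_maps_to (g := ρ) (t := R) (fun g _ => hρR g), Finset.mul_sum]
  refine Finset.sum_congr rfl fun r hr => ?_
  have h1 : ∑ g with ρ g = r, spTerm p K Ψ g = ∑ g with ρ g = r, spTerm p K Ψ r := by
    refine Finset.sum_congr rfl fun g hg => ?_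
    simp only [Finset.mem_filter, Finset.mem_univ, true_and] at hg
    obtain ⟨h, hh, k, hk, e⟩ := hρ g
    rw [e, hg, spTerm_congr p K Ψ r h k hh hk]
  rw [h1, Finset.sum_const, nsmul_eq_mul]
  by_cases hK : K ≤ (pairConj r p).1
  · congr 2
    rw [Nat.card_eq_fintype_card, ← Fintype.card_coe]
    symm
    refine Fintype.card_of_bijective (f := fun u : p.1 => ⟨r * u, ?_⟩) ⟨?_, ?_⟩
    · simp only [Finset.mem_filter, Finset.mem_univ, true_and]
      obtain ⟨h, hh, k, hk, e⟩ := hρ (r * u)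
      refine hR.2 _ (hρR _) _ hr ⟨h, hh, k * (u : G)⁻¹, p.1.mul_mem hk (p.1.inv_mem u.2), ?_⟩
      rw [← mul_assoc, ← e]; simp
    · intro u v huv
      simpa using huv
    · rintro ⟨g, hg⟩
      simp only [Finset.mem_filter, Finset.mem_univ, true_and] at hg
      obtain ⟨h, hh, k, hk, e⟩ := hρ g
      rw [hg] at e
      have h2 := (mem_pairConj r p h).1 (hK hh)
      refine ⟨⟨r⁻¹ * h * r * k, p.1.mul_mem h2 hk⟩, ?_⟩
      ext
      simp [e, mul_assoc]
  · simp [spTerm, hK]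

theorem dual_finite {X : Type*} [CommGroup X] [Finite X]
    (h : ∃ ζ : 𝕂, IsPrimitiveRoot ζ (Monoid.exponent X)) :
    Finite (X →* 𝕂ˣ) ∧ ∀ χ : X, χ ≠ 1 → ∃ Ψ : X →* 𝕂ˣ, Ψ χ ≠ 1 := by
  have : NeZero (Monoid.exponent X) := ⟨Monoid.exponent_ne_zero_of_finite⟩
  have : HasEnoughRootsOfUnity 𝕂 (Monoid.exponent X) := ⟨h, inferInstance⟩
  obtain ⟨e⟩ := CommGroup.monoidHom_mulEquiv_of_hasEnoughRootsOfUnity X 𝕂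
  exact ⟨Finite.of_equiv _ e.symm.toEquiv, fun χ hχ =>
    CommGroup.exists_apply_ne_one_of_hasEnoughRootsOfUnity X 𝕂 hχ⟩

theorem dual_sum {X : Type*} [CommGroup X] [Finite X]
    (h : ∃ ζ : 𝕂, IsPrimitiveRoot ζ (Monoid.exponent X)) [Fintype (X →* 𝕂ˣ)] (χ : X) :
    ∑ Ψ : X →* 𝕂ˣ, (Ψ χ : 𝕂) = if χ = 1 then (Nat.card X : 𝕂) else 0 := by
  split_ifs with hχ
  · subst hχ
    have : NeZero (Monoid.exponent X) := ⟨Monoid.exponent_ne_zero_of_finite⟩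
    have : HasEnoughRootsOfUnity 𝕂 (Monoid.exponent X) := ⟨h, inferInstance⟩
    have := CommGroup.card_monoidHom_of_hasEnoughRootsOfUnity X 𝕂
    simp [← this, Nat.card_eq_fintype_card]
  · obtain ⟨Ψ₀, hΨ⟩ := (dual_finite h).2 χ hχ
    have h1 : (Ψ₀ χ : 𝕂) * ∑ Ψ : X →* 𝕂ˣ, (Ψ χ : 𝕂) = ∑ Ψ : X →* 𝕂ˣ, (Ψ χ : 𝕂) := by
      rw [Finset.mul_sum]
      exact Fintype.sum_equiv (Equiv.mulLeft Ψ₀) _ _ (fun Ψ => by simp)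
    have h2 : (Ψ₀ χ : 𝕂) ≠ 1 := by simpa using hΨ
    have h3 : ((Ψ₀ χ : 𝕂) - 1) * ∑ Ψ : X →* 𝕂ˣ, (Ψ χ : 𝕂) = 0 := by
      linear_combination h1
    exact (mul_eq_zero.1 h3).resolve_left (sub_ne_zero.2 h2)

/-- The Moebius transform of the standard basis. -/
noncomputable def dB {G B : Type*} [Group G] [Fintype (Subgroup G)] [AddCommGroup B] [Module 𝕂 B]
    (b : (Σ U : Subgroup G, (↥U →* A)) → B) (μ : Subgroup G → Subgroup G → ℤ)
    (K : Subgroup G) (χ : K →* A) : B :=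
  ∑ L : Subgroup G, if h : L ≤ K then
    ((μ L K : 𝕂) * (Nat.card L : 𝕂)) • b ⟨L, χ.comp (Subgroup.inclusion h)⟩ else 0

theorem sum_dB {G B : Type*} [Group G] [Fintype (Subgroup G)] [AddCommGroup B] [Module 𝕂 B]
    (b : (Σ U : Subgroup G, (↥U →* A)) → B) (μ : Subgroup G → Subgroup G → ℤ)
    (hμ : ∀ a b, ∑ x, (if a ≤ x ∧ x ≤ b then μ a x else 0) = if a = b then 1 else 0)
    (p : Σ U : Subgroup G, (↥U →* A)) :
    ∑ K : Subgroup G, (if h : K ≤ p.1 then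
      dB (𝕂 := 𝕂) b μ K (p.2.comp (Subgroup.inclusion h)) else 0)
      = (Nat.card p.1 : 𝕂) • b p := by
  obtain ⟨U, φ⟩ := p
  let v : Subgroup G → B := fun L => if h : L ≤ U then
    (Nat.card L : 𝕂) • b ⟨L, φ.comp (Subgroup.inclusion h)⟩ else 0
  have h1 : ∀ K : Subgroup G, (if h : K ≤ U then
      dB (𝕂 := 𝕂) b μ K (φ.comp (Subgroup.inclusion h)) else 0)
      = ∑ L : Subgroup G, ((if L ≤ K ∧ K ≤ U then μ L K else 0 : ℤ) : 𝕂) • v L := by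
    intro K
    split_ifs with hK
    · unfold dB
      refine Finset.sum_congr rfl fun L _ => ?_
      by_cases hL : L ≤ K
      · simp only [hL, hK, v, dif_pos (hL.trans hK), dif_pos, and_self, if_true, smul_smul]
        rfl
      · simp [hL]
    · simp [hK]
  simp only [h1]
  rw [Finset.sum_comm]
  simp_rw [← Finset.sum_smul, ← Int.cast_sum, hμ]
  rw [Finset.sum_eq_single U]
  · simp only [if_true, v, le_refl, dif_pos]
    rw [Int.cast_one, one_smul]
    rfl
  · intro L _ hL
    simp [hL]
  · simp

theorem eG_recon {G B : Type*} [Group G] [Fintype G] [Fintype (Subgroup G)] [CharZero 𝕂]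
    [Ring B] [Algebra 𝕂 B]
    [∀ K : Subgroup G, Fintype (↥K →* A)] [∀ K : Subgroup G, Fintype ((↥K →* A) →* 𝕂ˣ)]
    (hsplitG : ∀ K : Subgroup G, ∃ ζ : 𝕂, IsPrimitiveRoot ζ (Monoid.exponent (↥K →* A)))
    (ℬG : FiberedBurnsideData A G 𝕂 B)
    (sG : ∀ K : Subgroup G, ((↥K →* A) →* 𝕂ˣ) → (B →ₗ[𝕂] 𝕂))
    (hsG : ∀ (K : Subgroup G) (Ψ : (↥K →* A) →* 𝕂ˣ) (p : Σ U : Subgroup G, (↥U →* A))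
      (R : Finset G), IsDCR K p.1 R →
      sG K Ψ (ℬG.b p) = ∑ r ∈ R, spTerm p K Ψ r)
    (μ : Subgroup G → Subgroup G → ℤ)
    (hμ : ∀ a b, ∑ x, (if a ≤ x ∧ x ≤ b then μ a x else 0) = if a = b then 1 else 0)
    (x : B) :
    ∑ K : Subgroup G, ∑ χ : K →* A, ((Nat.card (K →* A) : 𝕂)⁻¹ *
      ∑ Ψ : (↥K →* A) →* 𝕂ˣ, (Ψ χ⁻¹ : 𝕂) * sG K Ψ x) • dB (𝕂 := 𝕂) ℬG.b μ K χ
      = (Nat.card G : 𝕂) • x := by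
  have hx : x ∈ Submodule.span 𝕂 (Set.range ℬG.b) := by rw [ℬG.b_span]; trivial
  induction hx using Submodule.span_induction with
  | zero => simp
  | add x y _ _ hx hy =>
    rw [smul_add, ← hx, ← hy]
    simp only [map_add, mul_add, Finset.sum_add_distrib, add_smul]
  | smul a x _ hx =>
    rw [smul_comm, ← hx]
    simp only [map_smul, smul_eq_mul, Finset.smul_sum, smul_smul]
    refine Finset.sum_congr rfl fun K _ => Finset.sum_congr rfl fun χ _ => ?_
    congr 1
    rw [mul_left_comm, Finset.mul_sum (a := a)]
    congr 1
    exact Finset.sum_congr rfl fun Ψ _ => by ring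
  | mem x hx =>
    obtain ⟨p, rfl⟩ := hx
    have hU : (Nat.card p.1 : 𝕂) ≠ 0 := by exact_mod_cast Nat.card_pos.ne'
    have hs : ∀ K Ψ, sG K Ψ (ℬG.b p) = (Nat.card p.1 : 𝕂)⁻¹ * ∑ g : G, spTerm p K Ψ g := by
      intro K Ψ
      obtain ⟨R, hR⟩ := exists_DCR K p.1
      rw [hsG K Ψ p R hR, sum_spTerm p K Ψ R hR, inv_mul_cancel_left₀ hU]
    have hn : ∀ (K : Subgroup G) (χ : K →* A), (Nat.card (K →* A) : 𝕂)⁻¹ *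
      ∑ Ψ : (↥K →* A) →* 𝕂ˣ, (Ψ χ⁻¹ : 𝕂) * sG K Ψ (ℬG.b p) =
      (Nat.card p.1 : 𝕂)⁻¹ * ∑ g : G, (if h : K ≤ (pairConj g p).1 then
        (if (pairConj g p).2.comp (Subgroup.inclusion h) = χ then 1 else 0) else 0) := by
      intro K χ
      have hK : (Nat.card (K →* A) : 𝕂) ≠ 0 := by exact_mod_cast Nat.card_pos.ne'
      rw [inv_mul_eq_iff_eq_mul₀ hK]
      simp_rw [hs, mul_left_comm _ (Nat.card p.1 : 𝕂)⁻¹]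
      rw [← Finset.mul_sum]
      congr 1
      simp_rw [Finset.mul_sum]
      rw [Finset.sum_comm]
      refine Finset.sum_congr rfl fun g _ => ?_
      unfold spTerm
      split_ifs with h h2
      · have := dual_sum (hsplitG K) ((pairConj g p).2.comp (Subgroup.inclusion h) * χ⁻¹)
        rw [if_pos (mul_inv_eq_one.2 h2)] at this
        rw [mul_one, ← this]
        exact Finset.sum_congr rfl fun Ψ _ => by rw [map_mul, Units.val_mul, mul_comm]
      · have := dual_sum (hsplitG K) ((pairConj g p).2.comp (Subgroup.inclusion h) * χ⁻¹)
        rw [if_neg (fun h' => h2 (mul_inv_eq_one.1 h'))] at this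
        rw [mul_zero, ← this]
        exact Finset.sum_congr rfl fun Ψ _ => by rw [map_mul, Units.val_mul, mul_comm]
      · simp
    simp_rw [hn]
    have h3 : ∀ (K : Subgroup G), ∑ χ : K →* A,
      ((Nat.card p.1 : 𝕂)⁻¹ * ∑ g : G, (if h : K ≤ (pairConj g p).1 then
        (if (pairConj g p).2.comp (Subgroup.inclusion h) = χ then 1 else 0) else 0)) •
        dB (𝕂 := 𝕂) ℬG.b μ K χ = (Nat.card p.1 : 𝕂)⁻¹ • ∑ g : G,
          (if h : K ≤ (pairConj g p).1 then
            dB (𝕂 := 𝕂) ℬG.b μ K ((pairConj g p).2.comp (Subgroup.inclusion h)) else 0) := by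
      intro K
      simp_rw [mul_smul]
      rw [← Finset.smul_sum]
      congr 1
      simp_rw [Finset.sum_smul]
      rw [Finset.sum_comm]
      refine Finset.sum_congr rfl fun g _ => ?_
      split_ifs with h
      · simp
      · simp
    simp_rw [h3]
    rw [← Finset.smul_sum, Finset.sum_comm]
    simp_rw [sum_dB ℬG.b μ hμ]
    have h4 : ∀ g : G, Nat.card (pairConj g p).1 = Nat.card p.1 := fun g =>
      (Nat.card_congr (MulEquiv.subgroupMap (MulAut.conj g : G ≃* G) p.1).toEquiv).symm
    simp_rw [h4, ℬG.b_conj]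
    rw [Finset.sum_const, Finset.card_univ, ← Nat.card_eq_fintype_card, smul_comm,
      smul_smul, inv_mul_cancel₀ hU, one_smul, Nat.cast_smul_eq_nsmul]

theorem sigma_top_eq {G C : Type*} [Group G] [CommGroup C] (H : Subgroup G)
    (Ψ : (↥H →* A) →* C) (Φ : (↥(⊤ : Subgroup G) →* A) →* C) (hH : H = ⊤)
    (h : ∀ χ : G →* A, Ψ (χ.comp H.subtype) = Φ (χ.comp (⊤ : Subgroup G).subtype)) :
    (⟨H, Ψ⟩ : Σ H : Subgroup G, ((↥H →* A) →* C)) = ⟨⊤, Φ⟩ := by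
  subst hH
  congr 1
  ext χ
  have := h (χ.comp (Subgroup.topEquiv.symm.toMonoidHom))
  exact this

theorem charPairConj_top {G C : Type*} [Group G] [CommGroup C] (g : G)
    (Φ : (↥(⊤ : Subgroup G) →* A) →* C) :
    charPairConj g (⟨⊤, Φ⟩ : Σ H : Subgroup G, ((↥H →* A) →* C)) = ⟨⊤, Φ⟩ := by
  apply sigma_top_eq
  · exact Subgroup.map_top_of_surjective _ (MulAut.conj g : G ≃* G).surjective
  · intro χ
    change Φ _ = _
    congr 1
    ext ⟨x, hx⟩
    change χ (g * x * g⁻¹) = χ x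
    rw [map_mul, map_mul, map_inv, mul_comm, inv_mul_cancel_left]

theorem eG_formula {G B : Type*} [Group G] [Fintype G] [Fintype (Subgroup G)] [CharZero 𝕂]
    [Ring B] [Algebra 𝕂 B]
    [∀ K : Subgroup G, Fintype (↥K →* A)]
    (hsplitG : ∀ K : Subgroup G, ∃ ζ : 𝕂, IsPrimitiveRoot ζ (Monoid.exponent (↥K →* A)))
    (Φ : (↥(⊤ : Subgroup G) →* A) →* 𝕂ˣ)
    (ℬG : FiberedBurnsideData A G 𝕂 B)
    (sG : ∀ K : Subgroup G, ((↥K →* A) →* 𝕂ˣ) → (B →ₗ[𝕂] 𝕂))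
    (hsG : ∀ (K : Subgroup G) (Ψ : (↥K →* A) →* 𝕂ˣ) (p : Σ U : Subgroup G, (↥U →* A))
      (R : Finset G), IsDCR K p.1 R →
      sG K Ψ (ℬG.b p) = ∑ r ∈ R, spTerm p K Ψ r)
    (μ : Subgroup G → Subgroup G → ℤ)
    (hμ : ∀ a b, ∑ x, (if a ≤ x ∧ x ≤ b then μ a x else 0) = if a = b then 1 else 0)
    (eG : B)
    (heG : ∀ (K : Subgroup G) (Ψ : (↥K →* A) →* 𝕂ˣ),
      sG K Ψ eG = if ∃ g : G, charPairConj g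
        (⟨⊤, Φ⟩ : Σ K : Subgroup G, ((↥K →* A) →* 𝕂ˣ)) = ⟨K, Ψ⟩ then 1 else 0) :
    ((Nat.card G : 𝕂) * (Nat.card (↥(⊤ : Subgroup G) →* A) : 𝕂)) • eG =
    ∑ χ : (↥(⊤ : Subgroup G) →* A), (Φ χ⁻¹ : 𝕂) • dB (𝕂 := 𝕂) ℬG.b μ ⊤ χ := by
  have : ∀ K : Subgroup G, Finite ((↥K →* A) →* 𝕂ˣ) := fun K => (dual_finite (hsplitG K)).1
  have : ∀ K : Subgroup G, Fintype ((↥K →* A) →* 𝕂ˣ) := fun K => Fintype.ofFinite _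
  have hT : (Nat.card (↥(⊤ : Subgroup G) →* A) : 𝕂) ≠ 0 := by exact_mod_cast Nat.card_pos.ne'
  have h1 := eG_recon hsplitG ℬG sG hsG μ hμ eG
  simp_rw [charPairConj_top] at heG
  have h2 : ∀ Ψ, sG ⊤ Ψ eG = if Ψ = Φ then 1 else 0 := by
    intro Ψ
    rw [heG]
    congr 1
    simp [eq_comm]
  have h3 : ∀ K Ψ, K ≠ ⊤ → sG K Ψ eG = 0 := by
    intro K Ψ hK
    rw [heG, if_neg]
    rintro ⟨_, h⟩
    exact hK (congrArg Sigma.fst h).symm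
  rw [Finset.sum_eq_single ⊤] at h1
  · rw [mul_comm, mul_smul, ← h1, Finset.smul_sum]
    refine Finset.sum_congr rfl fun χ _ => ?_
    rw [smul_smul, mul_inv_cancel_left₀ hT]
    simp [h2]
  · intro K _ hK
    refine Finset.sum_eq_zero fun χ _ => ?_
    simp [h3 K _ hK]
  · simp

end Idem
section Defl

variable {A 𝕂 : Type*} [CommGroup A] [Field 𝕂]

/-- Characters of the full subgroup are the characters of the group. -/
def topCharEquiv {G : Type*} [Group G] : (G →* A) ≃ (↥(⊤ : Subgroup G) →* A) where
  toFun χ := χ.comp (⊤ : Subgroup G).subtype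
  invFun χ := χ.comp Subgroup.topEquiv.symm.toMonoidHom
  left_inv _ := rfl
  right_inv _ := rfl

theorem DCR_top {Q : Type*} [Group Q] (U : Subgroup Q) : IsDCR ⊤ U ({1} : Finset Q) := by
  refine ⟨fun x => ⟨1, by simp, x, trivial, 1, U.one_mem, by simp⟩, ?_⟩
  intro r hr r' hr' _
  simp only [Finset.mem_singleton] at hr hr'
  rw [hr, hr']

theorem defl_value {G B₁ B₂ : Type*} [Group G] [AddCommGroup B₁] [Module 𝕂 B₁]
    [AddCommGroup B₂] [Module 𝕂 B₂] (N : Subgroup G) [N.Normal]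
    (Ψ : (↥(⊤ : Subgroup (G ⧸ N)) →* A) →* 𝕂ˣ)
    (b : (Σ U : Subgroup G, (↥U →* A)) → B₁)
    (c : (Σ U : Subgroup (G ⧸ N), (↥U →* A)) → B₂)
    (sQN : ∀ K : Subgroup (G ⧸ N), ((↥K →* A) →* 𝕂ˣ) → (B₂ →ₗ[𝕂] 𝕂))
    (hsQN : ∀ (K : Subgroup (G ⧸ N)) (Ψ : (↥K →* A) →* 𝕂ˣ)
      (p : Σ U : Subgroup (G ⧸ N), (↥U →* A)) (R : Finset (G ⧸ N)), IsDCR K p.1 R →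
      sQN K Ψ (c p) = ∑ r ∈ R, spTerm p K Ψ r)
    (dN : B₁ →ₗ[𝕂] B₂)
    (hdN0 : ∀ p : Σ U : Subgroup G, (↥U →* A),
      (¬ ∀ u : ↥p.1, (u : G) ∈ N → p.2 u = 1) → dN (b p) = 0)
    (hdN1 : ∀ p : Σ U : Subgroup G, (↥U →* A),
      (∀ u : ↥p.1, (u : G) ∈ N → p.2 u = 1) →
      ∀ q : Σ V : Subgroup (G ⧸ N), (↥V →* A),
        q.1 = p.1.map (QuotientGroup.mk' N) →
        (∀ (u : ↥p.1) (hu : QuotientGroup.mk' N u ∈ q.1), q.2 ⟨_, hu⟩ = p.2 u) →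
        dN (b p) = c q)
    (K : Subgroup G) (χ : K →* A) :
    ((K.map (QuotientGroup.mk' N) ≠ ⊤ ∨ ¬ ∀ u : K, (u : G) ∈ N → χ u = 1) →
      sQN ⊤ Ψ (dN (b ⟨K, χ⟩)) = 0) ∧
    (K.map (QuotientGroup.mk' N) = ⊤ → ∀ η : (G ⧸ N) →* A,
      (∀ k : K, η (QuotientGroup.mk' N k) = χ k) →
      sQN ⊤ Ψ (dN (b ⟨K, χ⟩)) = Ψ (η.comp (⊤ : Subgroup (G ⧸ N)).subtype)) := by
  constructor
  · intro h
    by_cases h2 : ∀ u : K, (u : G) ∈ N → χ u = 1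
    · have h1 : K.map (QuotientGroup.mk' N) ≠ ⊤ := h.resolve_right (not_not.2 h2)
      let e := (QuotientGroup.mk' N).subgroupMap K
      have hs : Function.Surjective e := MonoidHom.subgroupMap_surjective _ _
      have hker : e.ker ≤ χ.ker := by
        intro k hk
        refine h2 k ?_
        have : QuotientGroup.mk' N k = 1 := congrArg Subtype.val (MonoidHom.mem_ker.1 hk)
        simpa using this
      let φ : K.map (QuotientGroup.mk' N) →* A := MonoidHom.liftOfSurjective e hs ⟨χ, hker⟩
      have hφ : ∀ k : K, φ (e k) = χ k := fun k =>
        MonoidHom.liftOfRightInverse_comp_apply _ _ _ _ k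
      rw [hdN1 ⟨K, χ⟩ h2 ⟨K.map (QuotientGroup.mk' N), φ⟩ rfl (fun u hu => hφ u),
        hsQN _ _ _ _ (DCR_top _), Finset.sum_singleton]
      unfold spTerm
      rw [dif_neg]
      intro h3
      apply h1
      rw [eq_top_iff]
      intro x _
      have := (mem_pairConj _ _ _).1 (h3 (Subgroup.mem_top x))
      simpa using this
    · rw [hdN0 ⟨K, χ⟩ h2, map_zero]
  · intro hK η hη
    have h2 : ∀ u : K, (u : G) ∈ N → χ u = 1 := by
      intro u hu
      have : QuotientGroup.mk' N (u : G) = 1 := by simpa using hu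
      rw [← hη u, this, map_one]
    rw [hdN1 ⟨K, χ⟩ h2 ⟨⊤, η.comp (⊤ : Subgroup (G ⧸ N)).subtype⟩ hK.symm (fun u hu => hη u),
      hsQN _ _ _ _ (DCR_top _), Finset.sum_singleton]
    unfold spTerm
    have h3 : (⊤ : Subgroup (G ⧸ N)) ≤ (pairConj 1 (⟨⊤, η.comp (⊤ : Subgroup (G ⧸ N)).subtype⟩ :
        Σ U : Subgroup (G ⧸ N), (↥U →* A))).1 := by
      intro x _
      rw [mem_pairConj]
      trivial
    rw [dif_pos h3]
    congr 2
    ext ⟨x, hx⟩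
    refine (pairConj_apply _ _ _ (h3 hx)).trans ?_
    change η (1⁻¹ * x * 1) = η x
    simp

theorem defl_formula {G B₁ B₂ : Type*} [Group G] [AddCommGroup B₁] [Module 𝕂 B₁]
    [AddCommGroup B₂] [Module 𝕂 B₂] [Fintype (Subgroup G)]
    (N : Subgroup G) [N.Normal]
    [Fintype (G →* A)] [Fintype (↥(⊤ : Subgroup G) →* A)] [Fintype ((G ⧸ N) →* A)]
    (Φ : (↥(⊤ : Subgroup G) →* A) →* 𝕂ˣ)
    (b : (Σ U : Subgroup G, (↥U →* A)) → B₁)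
    (μ : Subgroup G → Subgroup G → ℤ) (eG : B₁)
    (he : ((Nat.card G : 𝕂) * (Nat.card (↥(⊤ : Subgroup G) →* A) : 𝕂)) • eG =
      ∑ χ : (↥(⊤ : Subgroup G) →* A), (Φ χ⁻¹ : 𝕂) • dB (𝕂 := 𝕂) b μ ⊤ χ)
    (c : (Σ U : Subgroup (G ⧸ N), (↥U →* A)) → B₂)
    (sQN : ∀ K : Subgroup (G ⧸ N), ((↥K →* A) →* 𝕂ˣ) → (B₂ →ₗ[𝕂] 𝕂))
    (hsQN : ∀ (K : Subgroup (G ⧸ N)) (Ψ : (↥K →* A) →* 𝕂ˣ)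
      (p : Σ U : Subgroup (G ⧸ N), (↥U →* A)) (R : Finset (G ⧸ N)), IsDCR K p.1 R →
      sQN K Ψ (c p) = ∑ r ∈ R, spTerm p K Ψ r)
    (dN : B₁ →ₗ[𝕂] B₂)
    (hdN0 : ∀ p : Σ U : Subgroup G, (↥U →* A),
      (¬ ∀ u : ↥p.1, (u : G) ∈ N → p.2 u = 1) → dN (b p) = 0)
    (hdN1 : ∀ p : Σ U : Subgroup G, (↥U →* A),
      (∀ u : ↥p.1, (u : G) ∈ N → p.2 u = 1) →
      ∀ q : Σ V : Subgroup (G ⧸ N), (↥V →* A),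
        q.1 = p.1.map (QuotientGroup.mk' N) →
        (∀ (u : ↥p.1) (hu : QuotientGroup.mk' N u ∈ q.1), q.2 ⟨_, hu⟩ = p.2 u) →
        dN (b p) = c q)
    (eQN : B₂)
    (heQN : ∀ (K : Subgroup (G ⧸ N)) (Ψ : (↥K →* A) →* 𝕂ˣ),
       sQN K Ψ eQN = if ∃ g : G ⧸ N, charPairConj g
        (⟨⊤, Φ.comp (charPull A (QuotientGroup.mk' N))⟩ :
          Σ K : Subgroup (G ⧸ N), ((↥K →* A) →* 𝕂ˣ)) = ⟨K, Ψ⟩ then 1 else 0)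
    (mN : 𝕂) (hmN : dN eG = mN • eQN) :
    (Nat.card G : 𝕂) * (Nat.card (↥(⊤ : Subgroup G) →* A) : 𝕂) * mN =
      (Nat.card ((G ⧸ N) →* A) : 𝕂) *
      ∑ K : Subgroup G, (if K.map (QuotientGroup.mk' N) = ⊤ then
        (μ K ⊤ : 𝕂) * annSum (Φ.comp (pullHom A (⊤ : Subgroup G).subtype)) K else 0)
        * (Nat.card K : 𝕂) := by
  set Ψ := Φ.comp (charPull A (QuotientGroup.mk' N)) with hΨ
  have h1 : sQN ⊤ Ψ (dN eG) = mN := by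
    rw [hmN, map_smul, heQN, if_pos ⟨1, charPairConj_top 1 _⟩, smul_eq_mul, mul_one]
  have h2 := congrArg (fun x => sQN ⊤ Ψ (dN x)) he
  simp only [map_smul, h1, smul_eq_mul, map_sum] at h2
  rw [h2, ← Equiv.sum_comp topCharEquiv]
  have h3 : ∀ χ : G →* A, sQN ⊤ Ψ (dN (dB (𝕂 := 𝕂) b μ ⊤ (topCharEquiv χ)))
      = ∑ K : Subgroup G, ((μ K ⊤ : 𝕂) * (Nat.card K : 𝕂)) *
        sQN ⊤ Ψ (dN (b ⟨K, χ.comp K.subtype⟩)) := by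
    intro χ
    unfold dB
    rw [map_sum, map_sum]
    refine Finset.sum_congr rfl fun K _ => ?_
    rw [dif_pos le_top, map_smul, map_smul, smul_eq_mul]
    rfl
  simp_rw [h3, Finset.mul_sum]
  rw [Finset.sum_comm]
  refine Finset.sum_congr rfl fun K _ => ?_
  by_cases hK : K.map (QuotientGroup.mk' N) = ⊤
  · rw [if_pos hK]
    have key : ∑ χ : G →* A, (Φ (topCharEquiv χ)⁻¹ : 𝕂) *
        sQN ⊤ Ψ (dN (b ⟨K, χ.comp K.subtype⟩)) = (Nat.card ((G ⧸ N) →* A) : 𝕂) *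
        annSum (Φ.comp (pullHom A (⊤ : Subgroup G).subtype)) K := by
      unfold annSum
      rw [← Finset.sum_filter, Nat.card_eq_fintype_card, ← nsmul_eq_mul,
        ← Finset.card_univ, ← Finset.sum_const, ← Finset.sum_product']
      symm
      have hval := fun χ : G →* A => defl_value N Ψ b c sQN hsQN dN hdN0 hdN1 K
        (χ.comp K.subtype)
      have hlift : ∀ q : G ⧸ N, ∃ k ∈ K, QuotientGroup.mk' N k = q := by
        intro q
        have : q ∈ K.map (QuotientGroup.mk' N) := by rw [hK]; trivial
        exact this
      refine Finset.sum_of_injOn (fun x => x.1.comp (QuotientGroup.mk' N) * x.2⁻¹) ?_ ?_ ?_ ?_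
      · rintro ⟨η, κ⟩ h ⟨η', κ'⟩ h' e
        simp only [Finset.coe_product, Set.mem_prod, Finset.mem_coe, Finset.mem_filter,
          Finset.mem_univ, true_and] at h h' e
        have hη : η = η' := by
          apply MonoidHom.ext
          intro q
          obtain ⟨k, hk, rfl⟩ := hlift q
          have := DFunLike.congr_fun e k
          simpa [h k hk, h' k hk] using this
        subst hη
        simpa using e
      · intro x _
        simp
      · intro χ _ hχ
        rw [(hval χ).1 (Or.inr ?_), mul_zero]
        intro h4
        apply hχ
        obtain ⟨η, hη⟩ := exists_desc (QuotientGroup.mk' N) K hK (χ.comp K.subtype) (by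
          intro k hk
          exact h4 k (by simpa using hk))
        refine ⟨⟨η, η.comp (QuotientGroup.mk' N) * χ⁻¹⟩, ?_, ?_⟩
        · simp only [Finset.coe_product, Set.mem_prod, Finset.mem_coe, Finset.mem_filter,
            Finset.mem_univ, true_and]
          intro k hk
          have h5 : η (QuotientGroup.mk' N k) = χ k := hη ⟨k, hk⟩
          rw [MonoidHom.mul_apply, MonoidHom.comp_apply, h5, MonoidHom.inv_apply, mul_inv_cancel]
        · simp
      · rintro ⟨η, κ⟩ h
        simp only [Finset.mem_product, Finset.mem_filter, Finset.mem_univ, true_and] at h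
        rw [(hval _).2 hK η (fun k => by
          change η (QuotientGroup.mk' N k) = η (QuotientGroup.mk' N k) * (κ k)⁻¹
          rw [h k k.2]; simp)]
        rw [← Units.val_mul]
        congr 1
        rw [hΨ, MonoidHom.comp_apply, MonoidHom.comp_apply, ← map_mul]
        congr 1
        apply MonoidHom.ext
        intro x
        change κ x = (η (QuotientGroup.mk' N x) * (κ x)⁻¹)⁻¹ * η (QuotientGroup.mk' N x)
        rw [mul_inv_rev, inv_inv, inv_mul_cancel_right]
    calc _ = ((μ K ⊤ : 𝕂) * (Nat.card K : 𝕂)) * ∑ χ : G →* A, (Φ (topCharEquiv χ)⁻¹ : 𝕂) *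
        sQN ⊤ Ψ (dN (b ⟨K, χ.comp K.subtype⟩)) := by
          rw [Finset.mul_sum]
          exact Finset.sum_congr rfl fun _ _ => by ring
      _ = _ := by rw [key]; ring
  · rw [if_neg hK, zero_mul, mul_zero]
    refine Finset.sum_eq_zero fun χ _ => ?_
    rw [(defl_value N Ψ b c sQN hsQN dN hdN0 hdN1 K (χ.comp K.subtype)).1 (Or.inl hK)]
    ring

end Defl

theorem stmt_17 {A G 𝕂 B₁ B₂ B₃ : Type*} [CommGroup A] [Group G] [Fintype G]
    [Field 𝕂] [CharZero 𝕂]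
    [Ring B₁] [Algebra 𝕂 B₁] [Ring B₂] [Algebra 𝕂 B₂] [Ring B₃] [Algebra 𝕂 B₃]
    (hfinG : ∀ K : Subgroup G, Finite (↥K →* A))
    (hsplitG : ∀ K : Subgroup G, ∃ ζ : 𝕂, IsPrimitiveRoot ζ (Monoid.exponent (↥K →* A)))
    (N M : Subgroup G) [N.Normal] [M.Normal]
    -- an isomorphism f : G/N → G/M with Φ_N ∘ f* = Φ_M
    (f : (G ⧸ N) ≃* (G ⧸ M))
    (Φ : (↥(⊤ : Subgroup G) →* A) →* 𝕂ˣ)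
    (hΦ : (Φ.comp (charPull A (QuotientGroup.mk' N))).comp (charPull A f.toMonoidHom) =
      Φ.comp (charPull A (QuotientGroup.mk' M)))
    -- the fibered Burnside algebras of G, G/N and G/M
    (ℬG : FiberedBurnsideData A G 𝕂 B₁)
    (ℬQN : FiberedBurnsideData A (G ⧸ N) 𝕂 B₂)
    (ℬQM : FiberedBurnsideData A (G ⧸ M) 𝕂 B₃)
    -- the species homomorphisms of the three algebras
    (sG : ∀ K : Subgroup G, ((↥K →* A) →* 𝕂ˣ) → (B₁ →ₗ[𝕂] 𝕂))
    (hsG : ∀ (K : Subgroup G) (Ψ : (↥K →* A) →* 𝕂ˣ) (p : Σ U : Subgroup G, (↥U →* A))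
      (R : Finset G), IsDCR K p.1 R →
      sG K Ψ (ℬG.b p) = ∑ r ∈ R,
        (if h : K ≤ (pairConj r p).1 then
          ((Ψ ((pairConj r p).2.comp (Subgroup.inclusion h)) : 𝕂ˣ) : 𝕂) else 0))
    (sQN : ∀ K : Subgroup (G ⧸ N), ((↥K →* A) →* 𝕂ˣ) → (B₂ →ₗ[𝕂] 𝕂))
    (hsQN : ∀ (K : Subgroup (G ⧸ N)) (Ψ : (↥K →* A) →* 𝕂ˣ)
      (p : Σ U : Subgroup (G ⧸ N), (↥U →* A)) (R : Finset (G ⧸ N)), IsDCR K p.1 R →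
      sQN K Ψ (ℬQN.b p) = ∑ r ∈ R,
        (if h : K ≤ (pairConj r p).1 then
          ((Ψ ((pairConj r p).2.comp (Subgroup.inclusion h)) : 𝕂ˣ) : 𝕂) else 0))
    (sQM : ∀ K : Subgroup (G ⧸ M), ((↥K →* A) →* 𝕂ˣ) → (B₃ →ₗ[𝕂] 𝕂))
    (hsQM : ∀ (K : Subgroup (G ⧸ M)) (Ψ : (↥K →* A) →* 𝕂ˣ)
      (p : Σ U : Subgroup (G ⧸ M), (↥U →* A)) (R : Finset (G ⧸ M)), IsDCR K p.1 R →
      sQM K Ψ (ℬQM.b p) = ∑ r ∈ R,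
        (if h : K ≤ (pairConj r p).1 then
          ((Ψ ((pairConj r p).2.comp (Subgroup.inclusion h)) : 𝕂ˣ) : 𝕂) else 0))
    -- the two deflation maps
    (dN : B₁ →ₗ[𝕂] B₂)
    (hdN0 : ∀ p : Σ U : Subgroup G, (↥U →* A),
      (¬ ∀ u : ↥p.1, (u : G) ∈ N → p.2 u = 1) → dN (ℬG.b p) = 0)
    (hdN1 : ∀ p : Σ U : Subgroup G, (↥U →* A),
      (∀ u : ↥p.1, (u : G) ∈ N → p.2 u = 1) →
      ∀ q : Σ V : Subgroup (G ⧸ N), (↥V →* A),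
        q.1 = p.1.map (QuotientGroup.mk' N) →
        (∀ (u : ↥p.1) (hu : QuotientGroup.mk' N u ∈ q.1), q.2 ⟨_, hu⟩ = p.2 u) →
        dN (ℬG.b p) = ℬQN.b q)
    (dM : B₁ →ₗ[𝕂] B₃)
    (hdM0 : ∀ p : Σ U : Subgroup G, (↥U →* A),
      (¬ ∀ u : ↥p.1, (u : G) ∈ M → p.2 u = 1) → dM (ℬG.b p) = 0)
    (hdM1 : ∀ p : Σ U : Subgroup G, (↥U →* A),
      (∀ u : ↥p.1, (u : G) ∈ M → p.2 u = 1) →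
      ∀ q : Σ V : Subgroup (G ⧸ M), (↥V →* A),
        q.1 = p.1.map (QuotientGroup.mk' M) →
        (∀ (u : ↥p.1) (hu : QuotientGroup.mk' M u ∈ q.1), q.2 ⟨_, hu⟩ = p.2 u) →
        dM (ℬG.b p) = ℬQM.b q)
    -- the idempotents e^G_{(G,Φ)}, e^{G/N}_{(G/N,Φ_N)}, e^{G/M}_{(G/M,Φ_M)}
    (eG : B₁)
    (heG : ∀ (K : Subgroup G) (Ψ : (↥K →* A) →* 𝕂ˣ),
      sG K Ψ eG = if ∃ g : G, charPairConj g
        (⟨⊤, Φ⟩ : Σ K : Subgroup G, ((↥K →* A) →* 𝕂ˣ)) = ⟨K, Ψ⟩ then 1 else 0)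
    (eQN : B₂)
    (heQN : ∀ (K : Subgroup (G ⧸ N)) (Ψ : (↥K →* A) →* 𝕂ˣ),
       sQN K Ψ eQN = if ∃ g : G ⧸ N, charPairConj g
        (⟨⊤, Φ.comp (charPull A (QuotientGroup.mk' N))⟩ :
          Σ K : Subgroup (G ⧸ N), ((↥K →* A) →* 𝕂ˣ)) = ⟨K, Ψ⟩ then 1 else 0)
    (eQM : B₃)
    (heQM : ∀ (K : Subgroup (G ⧸ M)) (Ψ : (↥K →* A) →* 𝕂ˣ),
      sQM K Ψ eQM = if ∃ g : G ⧸ M, charPairConj g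
        (⟨⊤, Φ.comp (charPull A (QuotientGroup.mk' M))⟩ :
          Σ K : Subgroup (G ⧸ M), ((↥K →* A) →* 𝕂ˣ)) = ⟨K, Ψ⟩ then 1 else 0)
    -- the deflation constants m^N_{(G,Φ)} and m^M_{(G,Φ)}
    (mN mM : 𝕂)
    (hmN : dN eG = mN • eQN) (hmM : dM eG = mM • eQM) :
    mM = mN := by
  have : Fintype (Subgroup G) := Fintype.ofFinite _
  have : ∀ K : Subgroup G, Fintype (↥K →* A) := fun K => Fintype.ofFinite _
  have hfG : Finite (G →* A) := Finite.of_equiv _ (topCharEquiv (A := A) (G := G)).symm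
  have : Fintype (G →* A) := Fintype.ofFinite _
  have hfQ : ∀ (N : Subgroup G) [N.Normal], Finite ((G ⧸ N) →* A) := fun N _ =>
    Finite.of_injective (fun η : (G ⧸ N) →* A => η.comp (QuotientGroup.mk' N)) (by
      intro η η' h
      exact (MonoidHom.cancel_right (QuotientGroup.mk'_surjective N)).1 h)
  have hfQN := hfQ N
  have hfQM := hfQ M
  have : Fintype ((G ⧸ N) →* A) := Fintype.ofFinite _
  have : Fintype ((G ⧸ M) →* A) := Fintype.ofFinite _
  obtain ⟨μ, hμ, hμ'⟩ := exists_mu (Subgroup G)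
  have hμt : ∀ a, ∑ x, (if a ≤ x then μ x ⊤ else 0) = if a = ⊤ then 1 else 0 := by
    intro a
    simpa using hμ' a ⊤
  have he := eG_formula hsplitG Φ ℬG sG hsG μ hμ eG (fun K Ψ => (heG K Ψ).trans (by congr))
  have hN := defl_formula N Φ ℬG.b μ eG he ℬQN.b sQN hsQN dN hdN0 hdN1 eQN
    (fun K Ψ => (heQN K Ψ).trans (by congr)) mN hmN
  have hM := defl_formula M Φ ℬG.b μ eG he ℬQM.b sQM hsQM dM hdM0 hdM1 eQM
    (fun K Ψ => (heQM K Ψ).trans (by congr)) mM hmM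
  have hc : Nat.card ((G ⧸ N) →* A) = Nat.card ((G ⧸ M) →* A) :=
    Nat.card_congr
      { toFun := fun η => η.comp f.symm.toMonoidHom
        invFun := fun η => η.comp f.toMonoidHom
        left_inv := fun η => by ext x; simp
        right_inv := fun η => by ext x; simp }
  have hsum := comb_main (f.toMonoidHom.comp (QuotientGroup.mk' N)) (QuotientGroup.mk' M)
    (f.surjective.comp (QuotientGroup.mk'_surjective N)) (QuotientGroup.mk'_surjective M)
    (Φ.comp (pullHom A (⊤ : Subgroup G).subtype)) (by
      ext η
      have := DFunLike.congr_fun hΦ (η.comp (⊤ : Subgroup (G ⧸ M)).subtype)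
      exact congrArg Units.val this) (fun K => μ K ⊤) hμt
  have hmap : ∀ K : Subgroup G, K.map (f.toMonoidHom.comp (QuotientGroup.mk' N)) = ⊤ ↔
      K.map (QuotientGroup.mk' N) = ⊤ := by
    intro K
    rw [← Subgroup.map_map]
    constructor
    · intro h
      have h2 : (⊤ : Subgroup (G ⧸ N)).map f.toMonoidHom = ⊤ :=
        Subgroup.map_top_of_surjective _ f.surjective
      exact Subgroup.map_injective f.injective (h.trans h2.symm)
    · intro h
      rw [h]
      exact Subgroup.map_top_of_surjective _ f.surjective
  simp_rw [hmap] at hsum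
  rw [hc, hsum, ← hM] at hN
  have hG : (Nat.card G : 𝕂) ≠ 0 := by exact_mod_cast Nat.card_pos.ne'
  have hT : (Nat.card (↥(⊤ : Subgroup G) →* A) : 𝕂) ≠ 0 := by exact_mod_cast Nat.card_pos.ne'
  exact (mul_left_cancel₀ (mul_ne_zero hG hT) hN).symm
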